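/- Let A ⊆ ℝⁿ be a nonempty closed set and let r > 0. If A is r-strongly convex, then A is r-negatively E_r(A)-convex, where E_r(A) := {x ∈ ℝⁿ : there exists a ∈ A with ‖x − a‖ > r}. -/

import Mathlib

open scoped RealInnerProductSpace

variable {E : Type*} [NormedAddCommGroup E] [InnerProductSpace ℝ E]

/-- The proximal normal cone to `A` at `a`. -/
def proxNormalCone (A : Set E) (a : E) : Set E :=
  {ζ : E | ∃ σ : ℝ, 0 ≤ σ ∧ ∀ x ∈ A, ⟪ζ, x - a⟫ ≤ σ * ‖x - a‖ ^ 2}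

/-- `A` is `r`-strongly convex: it is the intersection of a nonempty family of
closed balls of radius `r`. -/
def IsStronglyConvex (r : ℝ) (A : Set E) : Prop :=
  ∃ C : Set E, C.Nonempty ∧ A = ⋂ c ∈ C, Metric.closedBall c r

/-- `A` is `r`-spherically supported. -/
def IsSphericallySupported (r : ℝ) (A : Set E) : Prop :=
  ∀ a ∈ frontier A, ∃ ζ ∈ proxNormalCone A a, ζ ≠ 0 ∧
    ∀ x ∈ A, ⟪‖ζ‖⁻¹ • ζ, x - a⟫ ≤ -(1 / (2 * r)) * ‖x - a‖ ^ 2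

/-- `A` is epi-Lipschitz (wedged). -/
def IsEpiLipschitz (A : Set E) : Prop :=
  ∀ a ∈ frontier A, ∃ v : E, ∃ ε : ℝ, 0 < ε ∧
    ∀ a' ∈ A, ‖a' - a‖ < ε → ∀ t : ℝ, 0 ≤ t → t < ε →
      ∀ w : E, ‖w - v‖ < ε → a' + t • w ∈ A

/-- The set of farthest points of `A` from `x`. -/
def farPoints (A : Set E) (x : E) : Set E :=
  {a : E | a ∈ A ∧ ∀ b ∈ A, ‖x - b‖ ≤ ‖x - a‖}

/-- `E_r(A)`: the set of points whose farthest distance to `A` exceeds `r`. -/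
def farExceeds (r : ℝ) (A : Set E) : Set E := {x : E | ∃ a ∈ A, r < ‖x - a‖}

/-- `A` is `r`-negatively `S`-convex. -/
def IsNegSConvex (r : ℝ) (S A : Set E) : Prop :=
  ¬ ∃ a ∈ frontier A, ∃ a' ∈ frontier A, a ≠ a' ∧
      ∃ ζ ∈ proxNormalCone A a, ‖ζ‖ = 1 ∧
        ∃ ζ' ∈ proxNormalCone A a', ‖ζ'‖ = 1 ∧
          ∃ t : ℝ, r < t ∧ ∃ t' : ℝ, r < t' ∧
            a - t • ζ = a' - t' • ζ' ∧ a - t • ζ ∈ S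

/-- `A` satisfies the exterior `r`-sphere condition. -/
def SatisfiesExtSphere (r : ℝ) (A : Set E) : Prop :=
  ∀ a ∈ frontier A, ∃ ζ ∈ proxNormalCone A a, ζ ≠ 0 ∧
    ∀ x ∈ A, ⟪‖ζ‖⁻¹ • ζ, x - a⟫ ≤ (1 / (2 * r)) * ‖x - a‖ ^ 2

/-- `A` is `r`-prox-regular. -/
def IsProxRegular (r : ℝ) (A : Set E) : Prop :=
  ∀ a ∈ frontier A, ∀ ζ ∈ proxNormalCone A a, ζ ≠ 0 →
    ∀ x ∈ A, ⟪‖ζ‖⁻¹ • ζ, x - a⟫ ≤ (1 / (2 * r)) * ‖x - a‖ ^ 2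

/-- A strongly convex set contains a ball around each point of a chord, of radius
`s * (1 - s) * ‖x - a‖ ^ 2 / (2 * r)` at parameter `s`. -/
theorem IsStronglyConvex.chord_add_mem {A : Set E} {r : ℝ} (hr : 0 < r)
    (hA : IsStronglyConvex r A) {a x : E} (ha : a ∈ A) (hx : x ∈ A) {s : ℝ}
    (hs0 : 0 ≤ s) (hs1 : s ≤ 1) {e : E}
    (he : ‖e‖ ≤ s * (1 - s) * (‖x - a‖ ^ 2 / (2 * r))) :
    a + (s • (x - a) + e) ∈ A := by
  obtain ⟨C, -, rfl⟩ := hA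
  simp only [Set.mem_iInter, Metric.mem_closedBall, dist_eq_norm] at ha hx ⊢
  intro c hc
  have h1 := ha c hc
  have h2 := hx c hc
  set q := s * (1 - s) * (‖x - a‖ ^ 2 / (2 * r)) with hq
  have hq2 : s * (1 - s) * ‖x - a‖ ^ 2 = 2 * r * q := by
    rw [hq]; field_simp
  have hid : ‖(a - c) + s • (x - a)‖ ^ 2 =
      (1 - s) * ‖a - c‖ ^ 2 + s * ‖x - c‖ ^ 2 - s * (1 - s) * ‖x - a‖ ^ 2 := by
    have hxc : x - c = (a - c) + (x - a) := by abel
    rw [hxc, norm_add_sq_real, norm_add_sq_real, inner_smul_right, norm_smul, mul_pow,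
      Real.norm_eq_abs, sq_abs]
    ring
  have h3 : ‖a - c‖ ^ 2 ≤ r ^ 2 := by gcongr
  have h4 : ‖x - c‖ ^ 2 ≤ r ^ 2 := by gcongr
  have h5 : ‖(a - c) + s • (x - a)‖ ^ 2 ≤ r ^ 2 - 2 * r * q := by
    rw [hid, hq2]
    nlinarith [mul_le_mul_of_nonneg_left h3 (sub_nonneg.2 hs1),
      mul_le_mul_of_nonneg_left h4 hs0]
  have hqr : q ≤ r := by
    have := sq_nonneg ‖(a - c) + s • (x - a)‖
    nlinarith
  have h6 : ‖(a - c) + s • (x - a)‖ ≤ r - q :=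
    abs_le_of_sq_le_sq' (by nlinarith [sq_nonneg q]) (sub_nonneg.2 hqr) |>.2
  calc ‖a + (s • (x - a) + e) - c‖ = ‖((a - c) + s • (x - a)) + e‖ := by congr 1; abel
    _ ≤ ‖(a - c) + s • (x - a)‖ + ‖e‖ := norm_add_le _ _
    _ ≤ r := by linarith

/-- Every unit proximal normal to an `r`-strongly convex set is realized by an enclosing
ball of radius `r`. -/
theorem IsStronglyConvex.inner_proxNormal_le {A : Set E} {r : ℝ} (hr : 0 < r)
    (hA : IsStronglyConvex r A) {a x ζ : E} (ha : a ∈ A) (hx : x ∈ A)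
    (hζ : ζ ∈ proxNormalCone A a) (hζ1 : ‖ζ‖ = 1) :
    ⟪ζ, x - a⟫ + ‖x - a‖ ^ 2 / (2 * r) ≤ 0 := by
  obtain ⟨σ, hσ, h⟩ := hζ
  by_contra! hP
  set K := ‖x - a‖ ^ 2 / (2 * r) with hK
  have hK0 : 0 ≤ K := by positivity
  set P := ⟪ζ, x - a⟫ + K with hPdef
  set Q := σ * (‖x - a‖ + K) ^ 2 + K with hQdef
  have hQ0 : 0 ≤ Q := by positivity
  obtain ⟨s, hs0, hs1, hsQ⟩ : ∃ s : ℝ, 0 < s ∧ s ≤ 1 ∧ s * Q < P := by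
    refine ⟨P / (Q + P), by positivity, ?_, ?_⟩
    · rw [div_le_one (by positivity)]; linarith
    · rw [div_mul_eq_mul_div, div_lt_iff₀ (by positivity)]; nlinarith
  have hq0 : 0 ≤ s * (1 - s) * K := by
    have := sub_nonneg.2 hs1
    positivity
  have hmem := hA.chord_add_mem hr ha hx hs0.le hs1 (e := (s * (1 - s) * K) • ζ)
    (by rw [norm_smul, hζ1, mul_one, Real.norm_of_nonneg hq0])
  have h1 := h _ hmem
  rw [add_sub_cancel_left, inner_add_right, inner_smul_right, inner_smul_right,
    real_inner_self_eq_norm_sq, hζ1] at h1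
  have h2 : ‖s • (x - a) + (s * (1 - s) * K) • ζ‖ ≤ s * (‖x - a‖ + K) := by
    refine (norm_add_le _ _).trans ?_
    rw [norm_smul, norm_smul, hζ1, Real.norm_of_nonneg hq0, Real.norm_of_nonneg hs0.le]
    nlinarith [mul_nonneg (mul_nonneg hs0.le hs0.le) hK0]
  have h3 : σ * ‖s • (x - a) + (s * (1 - s) * K) • ζ‖ ^ 2 ≤
      σ * (s * (‖x - a‖ + K)) ^ 2 := by gcongr
  have h4 : s * P ≤ s * (s * Q) := by
    rw [hPdef, hQdef]
    nlinarith
  exact absurd (le_of_mul_le_mul_left h4 hs0) (not_le.2 hsQ)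

/-- For `t > r`, the point `a` is the unique farthest point of a strongly convex set from
`a - t • ζ`, where `ζ` is a unit proximal normal at `a`. -/
theorem IsStronglyConvex.norm_sub_lt {A : Set E} {r : ℝ} (hr : 0 < r)
    (hA : IsStronglyConvex r A) {a x ζ : E} (ha : a ∈ A) (hx : x ∈ A) (hxa : x ≠ a)
    (hζ : ζ ∈ proxNormalCone A a) (hζ1 : ‖ζ‖ = 1) {t : ℝ} (ht : r < t) :
    ‖x - (a - t • ζ)‖ < t := by
  have h := hA.inner_proxNormal_le hr ha hx hζ hζ1
  have ht0 : 0 < t := hr.trans ht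
  have hd : 0 < ‖x - a‖ ^ 2 := by
    have := norm_pos_iff.2 (sub_ne_zero.2 hxa)
    positivity
  have hlt : ‖x - a‖ ^ 2 < 2 * t * (‖x - a‖ ^ 2 / (2 * r)) := by
    rw [mul_div_assoc', lt_div_iff₀ (by positivity)]
    nlinarith
  refine lt_of_pow_lt_pow_left₀ 2 ht0.le ?_
  have hrw : x - (a - t • ζ) = (x - a) + t • ζ := by abel
  rw [hrw, norm_add_sq_real, inner_smul_right, norm_smul, hζ1, mul_one, Real.norm_eq_abs,
    sq_abs, real_inner_comm]
  nlinarith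

theorem statement_4 {n : ℕ} (A : Set (EuclideanSpace ℝ (Fin n)))
    (hne : A.Nonempty) (hcl : IsClosed A) (r : ℝ) (hr : 0 < r)
    (hsc : IsStronglyConvex r A) :
    IsNegSConvex r (farExceeds r A) A := by
  rintro ⟨a, ha, a', ha', hne', ζ, hζ, hζ1, ζ', hζ', hζ1', t, ht, t', ht', heq, -⟩
  have haA := hcl.frontier_subset ha
  have haA' := hcl.frontier_subset ha'
  have h1 := hsc.norm_sub_lt hr haA haA' hne'.symm hζ hζ1 ht
  have h2 := hsc.norm_sub_lt hr haA' haA hne' hζ' hζ1' ht'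
  rw [heq, sub_sub_cancel, norm_smul, hζ1', mul_one,
    Real.norm_of_nonneg (hr.trans ht').le] at h1
  rw [← heq, sub_sub_cancel, norm_smul, hζ1, mul_one,
    Real.norm_of_nonneg (hr.trans ht).le] at h2
  exact lt_asymm h1 h2
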